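/- Let A be a finite left brace. Then the adjoint group A° of A is a nilpotent group if and only if Aⁿ = 0 for some natural number n. Moreover, when this holds, A is the direct sum of left braces whose cardinalities are powers of prime numbers. -/

import Mathlib

namespace Paper

/-- A left brace: an abelian group `(A,+)` with a multiplication `bmul` that is left
distributive over addition and such that the circle operation
`a ∘ b = a·b + a + b` makes `A` into a group (the adjoint group) with identity `0`. -/
class LeftBrace (A : Type*) extends AddCommGroup A where
  bmul : A → A → A
  bmul_add : ∀ a b c : A, bmul a (b + c) = bmul a b + bmul a c
  circ_assoc : ∀ a b c : A,
    bmul (bmul a b + a + b) c + (bmul a b + a + b) + c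
      = bmul a (bmul b c + b + c) + a + (bmul b c + b + c)
  zero_circ : ∀ a : A, bmul 0 a + 0 + a = a
  circ_zero : ∀ a : A, bmul a 0 + a + 0 = a
  exists_circ_inv : ∀ a : A, ∃ b : A, bmul a b + a + b = 0 ∧ bmul b a + b + a = 0

namespace LeftBrace

variable {A : Type*} [LeftBrace A]

/-- The circle operation `a ∘ b = a·b + a + b` of a left brace. -/
def circ (a b : A) : A := bmul a b + a + b

/-- The adjoint group `A°` of a left brace: the group `(A, ∘)`. -/
noncomputable def adjointGroup (A : Type*) [LeftBrace A] : Group A where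
  mul := circ
  one := (0 : A)
  inv a := Classical.choose (exists_circ_inv a)
  mul_assoc := circ_assoc
  one_mul := zero_circ
  mul_one := circ_zero
  inv_mul_cancel a := (Classical.choose_spec (exists_circ_inv a)).2

/-- The adjoint group `A°` of the left brace `A` is a nilpotent group. -/
def AdjointNilpotent (A : Type*) [LeftBrace A] : Prop :=
  @Group.IsNilpotent A (adjointGroup A)

/-- For subsets `C, D ⊆ A`, `C · D` is the set of all finite sums `Σ cᵢ·dᵢ`
with `cᵢ ∈ C`, `dᵢ ∈ D`, i.e. the additive submonoid generated by the products. -/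
def setMulSub (C D : Set A) : AddSubmonoid A :=
  AddSubmonoid.closure {x : A | ∃ c ∈ C, ∃ d ∈ D, x = bmul c d}

/-- `C · D` as a set. -/
def setMul (C D : Set A) : Set A := (setMulSub C D : Set A)

/-- `pow A n = Aⁿ` for `n ≥ 1`: `A¹ = A`, `A^{n+1} = A · Aⁿ`.  (`pow A 0` is set to `A`.) -/
def pow (A : Type*) [LeftBrace A] : ℕ → Set A
  | 0 => Set.univ
  | 1 => Set.univ
  | (n+2) => setMul Set.univ (pow A (n+1))

/-- `rpow A n = A^{(n)}` for `n ≥ 1`: `A^{(1)} = A`, `A^{(n+1)} = A^{(n)} · A`.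
(`rpow A 0` is set to `A`.) -/
def rpow (A : Type*) [LeftBrace A] : ℕ → Set A
  | 0 => Set.univ
  | 1 => Set.univ
  | (n+2) => setMul (rpow A (n+1)) Set.univ

/-- `brk A n = A^{[n]}` for `n ≥ 1`: `A^{[1]} = A`,
`A^{[n+1]} = Σ_{i=1}^{n} A^{[i]} · A^{[n+1-i]}`.  (`brk A 0` is set to `A`.) -/
def brk (A : Type*) [LeftBrace A] : ℕ → Set A
  | 0 => Set.univ
  | 1 => Set.univ
  | (n+2) =>
    (((Finset.range (n+1)).attach.sup
      (fun i => setMulSub (brk A (i.1 + 1)) (brk A (n + 1 - i.1)))) : AddSubmonoid A)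
  decreasing_by
  · have h := i.2; simp only [Finset.mem_range] at h; omega
  · omega


/-- The product of a family of left braces, with componentwise operations. -/
noncomputable def piBrace {ι : Type*} (B : ι → Type*) (instB : ∀ i, LeftBrace (B i)) :
    LeftBrace (∀ i, B i) :=
  letI : ∀ i, LeftBrace (B i) := instB
  { (inferInstance : AddCommGroup (∀ i, B i)) with
    bmul := fun f g i => bmul (f i) (g i)
    bmul_add := fun a b c => funext fun i => bmul_add (a i) (b i) (c i)
    circ_assoc := fun a b c => funext fun i => circ_assoc (a i) (b i) (c i)
    zero_circ := fun a => funext fun i => zero_circ (a i)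
    circ_zero := fun a => funext fun i => circ_zero (a i)
    exists_circ_inv := fun a =>
      ⟨fun i => Classical.choose (exists_circ_inv (a i)),
        funext fun i => (Classical.choose_spec (exists_circ_inv (a i))).1,
        funext fun i => (Classical.choose_spec (exists_circ_inv (a i))).2⟩ }

/-- An isomorphism of left braces: an additive isomorphism preserving the brace
multiplication. -/
structure BraceIso (A B : Type*) [LeftBrace A] [LeftBrace B] extends A ≃+ B where
  map_bmul : ∀ a b : A, toAddEquiv (bmul a b) = bmul (toAddEquiv a) (toAddEquiv b)

/-- `A` is the direct sum of (finitely many) left braces whose cardinalities are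
powers of prime numbers. -/
def IsPrimePowerDirectSum (A : Type*) [LeftBrace A] : Prop :=
  ∃ (k : ℕ) (B : Fin k → Type) (instB : ∀ i, LeftBrace (B i)),
    (∀ i, ∃ p m : ℕ, p.Prime ∧ Nat.card (B i) = p ^ m) ∧
    Nonempty (@BraceIso A (∀ i, B i) _ (piBrace B instB))


section AdjointAction

attribute [local instance] adjointGroup

theorem adjoint_mul_eq (a b : A) : a * b = bmul a b + a + b := rfl

theorem adjoint_one_eq : (1 : A) = 0 := rfl

@[simp]
theorem zero_bmul (a : A) : bmul 0 a = 0 := by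
  simpa using zero_circ a

@[simp]
theorem bmul_zero (a : A) : bmul a 0 = 0 := by
  simpa using circ_zero a

/-- The additive endomorphism `λ_a : b ↦ a·b + b` of a left brace. -/
def lam (a : A) : A →+ A where
  toFun b := bmul a b + b
  map_zero' := by simp
  map_add' b c := by rw [bmul_add]; abel

theorem lam_apply (a b : A) : lam a b = bmul a b + b := rfl

theorem lam_mul (a b c : A) : lam (a * b) c = lam a (lam b c) := by
  have h := circ_assoc a b c
  rw [bmul_add a, bmul_add a] at h
  simp only [lam_apply, adjoint_mul_eq, bmul_add a]
  rw [← sub_eq_zero] at h ⊢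
  rw [← h]
  abel

theorem lam_one (b : A) : lam (1 : A) b = b := by
  rw [lam_apply, adjoint_one_eq, zero_bmul, zero_add]

theorem lam_pow (a : A) (n : ℕ) (b : A) : lam (a ^ n) b = (lam a)^[n] b := by
  induction n with
  | zero => rw [pow_zero, lam_one, Function.iterate_zero_apply]
  | succ n ih => rw [pow_succ', lam_mul, ih, Function.iterate_succ_apply']

theorem lam_add_of_bmul_eq_zero {a b : A} (h : bmul b a = 0) (x : A) :
    lam (a + b) x = lam b (lam a x) := by
  rw [← lam_mul, adjoint_mul_eq, h, zero_add, add_comm]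

/-- The action of the adjoint group on the additive group, in multiplicative notation. -/
noncomputable def lamMulAut (A : Type*) [LeftBrace A] : A →* MulAut (Multiplicative A) where
  toFun a :=
    { toFun := fun b => .ofAdd (lam a b.toAdd)
      invFun := fun b => .ofAdd (lam a⁻¹ b.toAdd)
      left_inv := fun b => by
        beta_reduce
        rw [toAdd_ofAdd, ← lam_mul, inv_mul_cancel, lam_one, ofAdd_toAdd]
      right_inv := fun b => by
        beta_reduce
        rw [toAdd_ofAdd, ← lam_mul, mul_inv_cancel, lam_one, ofAdd_toAdd]
      map_mul' := fun b c => by rw [toAdd_mul, map_add, ofAdd_add] }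
  map_one' := MulEquiv.ext fun b => congrArg Multiplicative.ofAdd (lam_one b.toAdd)
  map_mul' a b := MulEquiv.ext fun c => congrArg Multiplicative.ofAdd (lam_mul a b c.toAdd)

/-- A left ideal of a left brace is a left brace. -/
abbrev ofLeftIdeal (H : AddSubgroup A) (hH : ∀ a, ∀ b ∈ H, bmul a b ∈ H) : LeftBrace H :=
  { (inferInstance : AddCommGroup H) with
    bmul := fun a b => ⟨bmul a.1 b.1, hH _ _ b.2⟩
    bmul_add := fun a b c => Subtype.ext (bmul_add a.1 b.1 c.1)
    circ_assoc := fun a b c => Subtype.ext (circ_assoc a.1 b.1 c.1)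
    zero_circ := fun a => Subtype.ext (zero_circ a.1)
    circ_zero := fun a => Subtype.ext (circ_zero a.1)
    exists_circ_inv := fun a => by
      obtain ⟨b, hab, hba⟩ := exists_circ_inv a.1
      have hb : b ∈ H := by
        have : b = -(bmul b a + a.1) := by
          rw [eq_neg_iff_add_eq_zero, ← hba]; abel
        rw [this]
        exact H.neg_mem (H.add_mem (hH _ _ a.2) a.2)
      exact ⟨⟨b, hb⟩, Subtype.ext hab, Subtype.ext hba⟩ }

/-- A left ideal of a left brace, as a subgroup of the adjoint group. -/
def adjointSubgroup (H : AddSubgroup A) (hH : ∀ a, ∀ b ∈ H, bmul a b ∈ H) : Subgroup A where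
  carrier := H
  one_mem' := H.zero_mem
  mul_mem' {a b} ha hb := H.add_mem (H.add_mem (hH _ _ hb) ha) hb
  inv_mem' {a} ha := by
    have h := inv_mul_cancel a
    rw [adjoint_mul_eq, adjoint_one_eq, add_right_comm] at h
    change a⁻¹ ∈ H
    rw [eq_neg_of_add_eq_zero_right h]
    exact H.neg_mem (H.add_mem (hH _ _ ha) ha)

theorem mem_torsionBy {n : ℕ} {a : A} : a ∈ AddSubgroup.torsionBy A (n : ℤ) ↔ n • a = 0 := by
  rw [← natCast_zsmul]; rfl

theorem bmul_mem_torsionBy (n : ℕ) (a : A) :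
    ∀ b ∈ AddSubgroup.torsionBy A (n : ℤ), bmul a b ∈ AddSubgroup.torsionBy A (n : ℤ) := by
  intro b hb
  rw [mem_torsionBy] at hb ⊢
  have h : n • lam a b = 0 := by rw [← map_nsmul, hb, map_zero]
  rwa [lam_apply, smul_add, hb, add_zero] at h

instance torsionByBrace (n : ℕ) : LeftBrace (AddSubgroup.torsionBy A (n : ℤ)) :=
  ofLeftIdeal _ (bmul_mem_torsionBy n)

theorem card_torsionBy_prime_pow [Finite A] {p : ℕ} (hp : p.Prime) (k : ℕ) :
    ∃ m, Nat.card (AddSubgroup.torsionBy A ((p ^ k : ℕ) : ℤ)) = p ^ m := by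
  have := Fact.mk hp
  have h : IsPGroup p (Multiplicative (AddSubgroup.torsionBy A ((p ^ k : ℕ) : ℤ))) := fun g =>
    ⟨k, congrArg Multiplicative.ofAdd
      (Subtype.ext (mem_torsionBy.1 g.toAdd.2) : p ^ k • g.toAdd = 0)⟩
  exact (IsPGroup.iff_card (G := Multiplicative _)).1 h

/-- The `n`-torsion of a left brace, as a subgroup of the adjoint group. -/
def torsionSubgroup (A : Type*) [LeftBrace A] (n : ℕ) : Subgroup A :=
  adjointSubgroup (AddSubgroup.torsionBy A (n : ℤ)) (bmul_mem_torsionBy n)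

theorem mem_torsionSubgroup {n : ℕ} {a : A} : a ∈ torsionSubgroup A n ↔ n • a = 0 :=
  mem_torsionBy

theorem isPGroup_torsionSubgroup [Finite A] {p : ℕ} (hp : p.Prime) (k : ℕ) :
    IsPGroup p (torsionSubgroup A (p ^ k)) :=
  have ⟨_, hm⟩ := card_torsionBy_prime_pow (A := A) hp k
  IsPGroup.of_card hm

/-- Elements of a left brace whose additive orders are powers of distinct primes have
product zero. -/
def PrimaryOrthogonal (A : Type*) [LeftBrace A] : Prop :=
  ∀ p q k l : ℕ, p.Prime → q.Prime → p ≠ q → ∀ a b : A, p ^ k • a = 0 → q ^ l • b = 0 →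
    bmul a b = 0

theorem eq_zero_of_coprime_nsmul {m n : ℕ} (h : m.Coprime n) {x : A} (hm : m • x = 0)
    (hn : n • x = 0) : x = 0 := by
  rw [← addOrderOf_dvd_iff_nsmul_eq_zero] at hm hn
  rw [← AddMonoid.addOrderOf_eq_one_iff]
  exact Nat.eq_one_of_dvd_coprimes h hm hn

theorem AdjointNilpotent.primaryOrthogonal [Finite A] (h : AdjointNilpotent A) :
    PrimaryOrthogonal A := by
  intro p q k l hp hq hpq a b ha hb
  have := Fact.mk hp
  have := Fact.mk hq
  have : Group.IsNilpotent A := h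
  obtain ⟨P, hP⟩ := (isPGroup_torsionSubgroup (A := A) hp k).exists_le_sylow
  obtain ⟨Q, hQ⟩ := (isPGroup_torsionSubgroup (A := A) hq l).exists_le_sylow
  have hcomm : a * b = b * a :=
    Subgroup.commute_of_normal_of_disjoint (P : Subgroup A) (Q : Subgroup A)
      inferInstance inferInstance
      (IsPGroup.disjoint_of_ne p q hpq _ _ P.isPGroup' Q.isPGroup') a b
      (hP (mem_torsionSubgroup.2 ha)) (hQ (mem_torsionSubgroup.2 hb))
  have heq : bmul a b = bmul b a := by
    rw [adjoint_mul_eq, adjoint_mul_eq, add_assoc, add_assoc, add_comm b a] at hcomm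
    exact add_right_cancel hcomm
  refine eq_zero_of_coprime_nsmul (Nat.coprime_pow_primes k l hp hq hpq) ?_
    (mem_torsionBy.1 (bmul_mem_torsionBy _ a b (mem_torsionBy.2 hb)))
  rw [heq]
  exact mem_torsionBy.1 (bmul_mem_torsionBy _ b a (mem_torsionBy.2 ha))

theorem bmul_mem_pow {n : ℕ} (a : A) {x : A} (hx : x ∈ pow A (n + 1)) :
    bmul a x ∈ pow A (n + 2) :=
  AddSubmonoid.subset_closure ⟨a, Set.mem_univ a, x, hx, rfl⟩

theorem iterate_bmul_mem_pow (a b : A) (n : ℕ) : (bmul a)^[n] b ∈ pow A (n + 1) := by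
  induction n with
  | zero => exact Set.mem_univ _
  | succ n ih =>
    rw [Function.iterate_succ_apply']
    exact bmul_mem_pow a ih

theorem zero_mem_pow (A : Type*) [LeftBrace A] (n : ℕ) : (0 : A) ∈ pow A (n + 1) := by
  cases n with
  | zero => exact Set.mem_univ _
  | succ n => exact AddSubmonoid.zero_mem _

theorem pow_succ_subset (A : Type*) [LeftBrace A] (n : ℕ) : pow A (n + 2) ⊆ pow A (n + 1) := by
  induction n with
  | zero => exact Set.subset_univ _
  | succ n ih =>
    refine AddSubmonoid.closure_mono ?_
    rintro x ⟨a, ha, b, hb, rfl⟩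
    exact ⟨a, ha, b, ih hb, rfl⟩

theorem pow_subset_of_le (A : Type*) [LeftBrace A] {m n : ℕ} (h : m ≤ n) :
    pow A (n + 1) ⊆ pow A (m + 1) :=
  antitone_nat_of_succ_le (f := fun n => pow A (n + 1)) (pow_succ_subset A) h

theorem map_mem_pow {B : Type*} [LeftBrace B] (f : A →+ B)
    (hf : ∀ a b, f (bmul a b) = bmul (f a) (f b)) {n : ℕ} {x : A} (hx : x ∈ pow A (n + 1)) :
    f x ∈ pow B (n + 1) := by
  induction n generalizing x with
  | zero => exact Set.mem_univ _
  | succ n ih =>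
    change x ∈ (setMulSub _ _).comap f
    refine AddSubmonoid.closure_le.2 ?_ hx
    rintro _ ⟨a, -, b, hb, rfl⟩
    change f (bmul a b) ∈ pow B (n + 2)
    rw [hf]
    exact bmul_mem_pow _ (ih hb)

theorem iterate_lam_of_bmul_bmul_eq_zero {a x : A} (h : bmul a (bmul a x) = 0) (n : ℕ) :
    (lam a)^[n] x = x + n • bmul a x := by
  induction n with
  | zero => simp
  | succ n ih =>
    have h' : lam a (bmul a x) = bmul a x := by rw [lam_apply, h, zero_add]
    rw [Function.iterate_succ_apply', ih, map_add, map_nsmul, h', lam_apply, succ_nsmul]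
    abel

theorem primaryOrthogonal_of_pow_eq_zero [Finite A] {n : ℕ} (h : pow A (n + 1) = {0}) :
    PrimaryOrthogonal A := by
  intro p q k l hp hq hpq a b ha hb
  obtain ⟨j, hj⟩ := isPGroup_torsionSubgroup (A := A) hp k ⟨a, mem_torsionSubgroup.2 ha⟩
  replace hj : a ^ p ^ j = 1 := congrArg Subtype.val hj
  have key : ∀ x : A, q ^ l • x = 0 → bmul a (bmul a x) = 0 → bmul a x = 0 := by
    intro x hx hxx
    have h1 := iterate_lam_of_bmul_bmul_eq_zero hxx (p ^ j)
    rw [← lam_pow, hj, lam_one, left_eq_add] at h1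
    exact eq_zero_of_coprime_nsmul (Nat.coprime_pow_primes j l hp hq hpq) h1
      (mem_torsionBy.1 (bmul_mem_torsionBy _ a x (mem_torsionBy.2 hx)))
  have hiter : ∀ m : ℕ, ∀ x : A, q ^ l • x = 0 → (bmul a)^[m] x = 0 → bmul a x = 0 := by
    intro m
    induction m with
    | zero =>
      intro x _ hm
      rw [Function.iterate_zero_apply] at hm
      rw [hm, bmul_zero]
    | succ m ih =>
      intro x hx hm
      exact key x hx (ih _ (mem_torsionBy.1 (bmul_mem_torsionBy _ a x (mem_torsionBy.2 hx))) hm)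
  exact hiter n b hb (by simpa [h] using iterate_bmul_mem_pow a b n)

theorem inl_mem_lowerCentralSeries {n : ℕ} {x : A} (hx : x ∈ pow A (n + 1)) :
    (SemidirectProduct.inl (.ofAdd x) : Multiplicative A ⋊[lamMulAut A] A) ∈
      (⊤ : Subgroup (Multiplicative A ⋊[lamMulAut A] A)).lowerCentralSeries n := by
  induction n generalizing x with
  | zero => exact Subgroup.mem_top _
  | succ n ih =>
    have hle : setMulSub Set.univ (pow A (n + 1)) ≤
        (Subgroup.toAddSubgroup' (((⊤ : Subgroup
          (Multiplicative A ⋊[lamMulAut A] A)).lowerCentralSeries (n + 1)).comap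
            SemidirectProduct.inl)).toAddSubmonoid := by
      refine AddSubmonoid.closure_le.2 ?_
      rintro _ ⟨a, -, b, hb, rfl⟩
      have hcomm := Subgroup.commutator_mem_commutator
        (Subgroup.mem_top (SemidirectProduct.inr a : Multiplicative A ⋊[lamMulAut A] A)) (ih hb)
      rw [Subgroup.commutator_comm, commutatorElement_def, ← map_inv, ← SemidirectProduct.inl_aut,
        ← map_inv, ← map_mul] at hcomm
      have heq : lamMulAut A a (.ofAdd b) * (.ofAdd b)⁻¹ = .ofAdd (bmul a b) :=
        congrArg Multiplicative.ofAdd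
          (add_neg_cancel_right (bmul a b) b)
      rwa [heq] at hcomm
    exact hle hx

theorem exists_pow_eq_zero_of_card_eq {p m : ℕ} (hp : p.Prime) (hA : Nat.card A = p ^ m) :
    ∃ n, pow A (n + 1) = {0} := by
  have := Fact.mk hp
  have : Finite A := Nat.finite_of_card_ne_zero (hA ▸ (pow_pos hp.pos m).ne')
  have : Finite (Multiplicative A ⋊[lamMulAut A] A) := .of_equiv _ SemidirectProduct.equivProd.symm
  have hcard : Nat.card (Multiplicative A ⋊[lamMulAut A] A) = p ^ (m + m) := by
    rw [SemidirectProduct.card, Nat.card_congr Multiplicative.toAdd, hA, pow_add]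
  obtain ⟨n, hn⟩ := Subgroup.nilpotent_iff_lowerCentralSeries.1 (IsPGroup.of_card hcard).isNilpotent
  refine ⟨n, Set.eq_singleton_iff_unique_mem.2 ⟨zero_mem_pow A n, fun x hx => ?_⟩⟩
  have h := inl_mem_lowerCentralSeries hx
  rw [hn, Subgroup.mem_bot, ← map_one SemidirectProduct.inl] at h
  exact congrArg Multiplicative.toAdd (SemidirectProduct.inl_injective h)

theorem adjointNilpotent_of_card_eq {p m : ℕ} (hp : p.Prime) (hA : Nat.card A = p ^ m) :
    AdjointNilpotent A := by
  have := Fact.mk hp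
  have : Finite A := Nat.finite_of_card_ne_zero (hA ▸ (pow_pos hp.pos m).ne')
  exact (IsPGroup.of_card hA).isNilpotent

theorem isPrimePowerDirectSum_iff : IsPrimePowerDirectSum A ↔
    ∃ (k : ℕ) (B : Fin k → Type) (_ : ∀ i, LeftBrace (B i)) (f : A ≃+ ∀ i, B i),
      (∀ i, ∃ p m : ℕ, p.Prime ∧ Nat.card (B i) = p ^ m) ∧
      ∀ a b, f (bmul a b) = fun i => bmul (f a i) (f b i) := by
  constructor
  · rintro ⟨k, B, instB, hcard, ⟨e⟩⟩
    exact ⟨k, B, instB, @BraceIso.toAddEquiv A _ _ (piBrace B instB) e, hcard,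
      @BraceIso.map_bmul A _ _ (piBrace B instB) e⟩
  · rintro ⟨k, B, instB, f, hcard, hf⟩
    exact ⟨k, B, instB, hcard, ⟨@BraceIso.mk A _ _ (piBrace B instB) f hf⟩⟩

theorem IsPrimePowerDirectSum.exists_pow_eq_zero (h : IsPrimePowerDirectSum A) :
    ∃ n, pow A (n + 1) = {0} := by
  obtain ⟨k, B, instB, f, hcard, hf⟩ := isPrimePowerDirectSum_iff.1 h
  choose p m hp hc using hcard
  choose n hn using fun i => exists_pow_eq_zero_of_card_eq (hp i) (hc i)
  refine ⟨Finset.univ.sup n, Set.eq_singleton_iff_unique_mem.2 ⟨zero_mem_pow A _, fun x hx => ?_⟩⟩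
  refine f.map_eq_zero_iff.1 (funext fun i => ?_)
  have hx' := pow_subset_of_le (B i) (Finset.le_sup (Finset.mem_univ i)) <|
    map_mem_pow ((Pi.evalAddMonoidHom B i).comp f.toAddMonoidHom)
      (fun a b => congrFun (hf a b) i) hx
  rw [hn i] at hx'
  exact hx'

theorem IsPrimePowerDirectSum.adjointNilpotent (h : IsPrimePowerDirectSum A) :
    AdjointNilpotent A := by
  obtain ⟨k, B, instB, f, hcard, hf⟩ := isPrimePowerDirectSum_iff.1 h
  have (i : Fin k) : Group.IsNilpotent (B i) :=
    have ⟨_, _, hp, hc⟩ := hcard i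
    adjointNilpotent_of_card_eq hp hc
  let g : A ≃* ∀ i, B i :=
    { f.toEquiv with
      map_mul' := fun a b => by
        change f (bmul a b + a + b) = (fun i => bmul (f a i) (f b i)) + f a + f b
        rw [map_add, map_add, hf] }
  exact (Group.isNilpotent_congr g).2 inferInstance

theorem bmul_sum (a : A) {ι : Type*} (s : Finset ι) (f : ι → A) :
    bmul a (∑ i ∈ s, f i) = ∑ i ∈ s, bmul a (f i) :=
  map_sum (AddMonoidHom.mk' (bmul a) (bmul_add a)) f s

theorem sum_bmul_of_pairwise {ι : Type*} [DecidableEq ι] (s : Finset ι) (f g : ι → A)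
    (hff : ∀ i j, i ≠ j → bmul (f i) (f j) = 0) (hfg : ∀ i j, i ≠ j → bmul (f i) (g j) = 0)
    (hffg : ∀ i j, i ≠ j → bmul (f i) (bmul (f j) (g j)) = 0) (j : ι) :
    bmul (∑ i ∈ s, f i) (g j) = if j ∈ s then bmul (f j) (g j) else 0 := by
  induction s using Finset.induction_on with
  | empty => simp
  | insert r s hr ih =>
    have hr0 : bmul (f r) (∑ i ∈ s, f i) = 0 := by
      rw [bmul_sum]
      exact Finset.sum_eq_zero fun i hi => hff r i (ne_of_mem_of_not_mem hi hr).symm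
    have h := lam_add_of_bmul_eq_zero hr0 (g j)
    simp only [lam_apply, ih] at h
    rw [Finset.sum_insert hr, add_comm]
    by_cases hjr : j = r
    · subst hjr
      simpa [hr] using h
    · by_cases hjs : j ∈ s
      · simpa [hjs, bmul_add, hfg r j (Ne.symm hjr), hffg r j (Ne.symm hjr), add_left_inj] using h
      · simpa [hjs, hjr, hfg r j (Ne.symm hjr)] using h

end AdjointAction

theorem PrimaryOrthogonal.isPrimePowerDirectSum {A : Type} [LeftBrace A] [Finite A]
    (h : PrimaryOrthogonal A) : IsPrimePowerDirectSum A := by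
  classical
  let N := Nat.card A
  let S := N.primeFactors
  let q : ℕ → ℕ := fun p => p ^ N.factorization p
  have hprime (p : S) : (p : ℕ).Prime := Nat.prime_of_mem_primeFactors p.2
  have hN : ∏ p ∈ S, q p = N := Nat.prod_factorization_pow_eq_self Nat.card_pos.ne'
  have htors : Module.IsTorsionBy ℤ A (∏ p ∈ S, (q p : ℤ)) := by
    intro x
    rw [← Nat.cast_prod, hN, natCast_zsmul]
    exact card_nsmul_eq_zero'
  have hcop : (S : Set ℕ).Pairwise (Function.onFun IsCoprime fun p => (q p : ℤ)) :=
    fun p hp r hr hpr => Nat.isCoprime_iff_coprime.2 <|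
      Nat.coprime_pow_primes _ _ (Nat.prime_of_mem_primeFactors hp)
        (Nat.prime_of_mem_primeFactors hr) hpr
  have hint := Submodule.torsionBy_isInternal hcop htors
  let C : S → Type := fun p => AddSubgroup.torsionBy A (q p : ℤ)
  have hzero {p r : S} (hpr : p ≠ r) {a b : A} (ha : a ∈ AddSubgroup.torsionBy A (q p : ℤ))
      (hb : b ∈ AddSubgroup.torsionBy A (q r : ℤ)) : bmul a b = 0 :=
    h p r _ _ (hprime p) (hprime r) (Subtype.coe_ne_coe.2 hpr) a b
      (mem_torsionBy.1 ha) (mem_torsionBy.1 hb)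
  let sumHom : (∀ p : S, AddSubgroup.torsionBy A (q p : ℤ)) →+ A :=
    { toFun := fun f => ∑ p, (f p : A)
      map_zero' := by simp
      map_add' := fun f g => by simp [Finset.sum_add_distrib] }
  have hbij : Function.Bijective sumHom := by
    convert! hint.comp DFinsupp.equivFunOnFintype.symm.bijective using 1
    funext f
    rw [Function.comp_apply, DirectSum.coeAddMonoidHom_eq_dfinsuppSum,
      DFinsupp.sum_eq_sum_fintype _ fun _ => rfl, Equiv.apply_symm_apply]
    rfl
  have hmul (f g : ∀ p : S, AddSubgroup.torsionBy A (q p : ℤ)) :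
      sumHom (fun p => bmul (f p) (g p)) = bmul (sumHom f) (sumHom g) := by
    change ∑ p, bmul (f p : A) (g p : A) = bmul (∑ p, (f p : A)) (∑ p, (g p : A))
    rw [bmul_sum]
    refine Finset.sum_congr rfl fun p _ => ?_
    rw [sum_bmul_of_pairwise Finset.univ (fun p => (f p : A)) (fun p => (g p : A))
      (fun i j hij => hzero hij (f i).2 (f j).2) (fun i j hij => hzero hij (f i).2 (g j).2)
      (fun i j hij => hzero hij (f i).2 (bmul_mem_torsionBy _ _ _ (g j).2)),
      if_pos (Finset.mem_univ p)]
  let e := S.equivFin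
  let iso : A ≃+ ∀ i, C (e.symm i) :=
    (AddEquiv.ofBijective sumHom hbij).symm.trans
      { Equiv.piCongrLeft' C e with map_add' := fun _ _ => rfl }
  refine isPrimePowerDirectSum_iff.2 ⟨S.card, fun i => C (e.symm i),
    fun i => torsionByBrace (q (e.symm i)), iso, fun i => ?_, fun a b => ?_⟩
  · obtain ⟨m, hm⟩ := card_torsionBy_prime_pow (A := A) (hprime (e.symm i)) (N.factorization _)
    exact ⟨_, m, hprime (e.symm i), hm⟩
  · obtain ⟨f, rfl⟩ := hbij.2 a
    obtain ⟨g, rfl⟩ := hbij.2 b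
    have hiso (f : ∀ p : S, AddSubgroup.torsionBy A (q p : ℤ)) :
        iso (sumHom f) = fun i => f (e.symm i) :=
      congrArg (Equiv.piCongrLeft' C e) ((AddEquiv.ofBijective sumHom hbij).symm_apply_apply f)
    rw [← hmul, hiso, hiso, hiso]

/-- Let `A` be a finite left brace. Then the adjoint group `A°` of `A`
is nilpotent if and only if `Aⁿ = 0` for some natural number `n`; moreover, when this
holds, `A` is the direct sum of left braces whose cardinalities are powers of primes. -/
theorem finite_leftBrace_adjoint_nilpotent_iff
    (A : Type) [LeftBrace A] [Finite A] :
    (AdjointNilpotent A ↔ ∃ n : ℕ, 1 ≤ n ∧ pow A n = {0}) ∧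
    (AdjointNilpotent A → IsPrimePowerDirectSum A) := by
  refine ⟨⟨fun h => ?_, ?_⟩, fun h => h.primaryOrthogonal.isPrimePowerDirectSum⟩
  · obtain ⟨n, hn⟩ := h.primaryOrthogonal.isPrimePowerDirectSum.exists_pow_eq_zero
    exact ⟨n + 1, Nat.le_add_left 1 n, hn⟩
  · rintro ⟨n, hn, hpow⟩
    obtain ⟨m, rfl⟩ := Nat.exists_eq_add_of_le' hn
    exact (primaryOrthogonal_of_pow_eq_zero hpow).isPrimePowerDirectSum.adjointNilpotent

end LeftBrace

end Paper
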